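/- Let G = ((S,E),(S₁,S₂)) be a game graph and p : S → {0,…,d−1} a priority function. Define the sequence of subgames and attractor sets of the classical algorithm: G⁰ = G with state space S⁰ = S, and for 0 ≤ i < d, A_i = Attr_{(i mod 2)+1}(p⁻¹(i) ∩ S^i, G^i) computed in G^i, and G^{i+1} = G^i restricted to S^{i+1} = S^i \ A_i. Then the union of the even-indexed attractor sets is exactly the winning set of player 1 for the weak-parity objective, and the union of the odd-indexed attractor sets is exactly the winning set of player 2 for the complementary objective: ⋃_{i even} A_i = W₁^G(WeakParityEven(p)) and ⋃_{i odd} A_i = S \ ⋃_{i even} A_i = W₂^G(WeakParityOdd(p)). -/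

import Mathlib

open scoped Classical

/-! Framework for two-player games on graphs.

A game graph on a state type `S` is given by an edge relation `E : S → S → Prop`,
the set `S1 : Set S` of player-1 states (player-2 states are `S1ᶜ`), together with
the assumption that every state has a successor.  To deal uniformly with sub-games,
all notions are relativized to a carrier set `C : Set S` of states (the full game
corresponds to `C = Set.univ`). -/

/-- A (history-dependent) strategy for player 1 in the game with carrier `C`:
given the history `w` (the play so far, excluding the current state) and the
current state `s` (a player-1 state of the game), it chooses a successor of `s`
inside the game. -/
def Strategy1 {S : Type} (C : Set S) (E : S → S → Prop) (S1 : Set S)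
    (σ : List S → S → S) : Prop :=
  ∀ w s, s ∈ C → s ∈ S1 → E s (σ w s) ∧ σ w s ∈ C

/-- A (history-dependent) strategy for player 2 in the game with carrier `C`. -/
def Strategy2 {S : Type} (C : Set S) (E : S → S → Prop) (S1 : Set S)
    (π : List S → S → S) : Prop :=
  ∀ w s, s ∈ C → s ∉ S1 → E s (π w s) ∧ π w s ∈ C

/-- Auxiliary function: the pair (history, current state) after `n` steps of the
play from `s` in which player 1 follows `σ` and player 2 follows `π`. -/
noncomputable def playAux {S : Type} (S1 : Set S) (σ π : List S → S → S) (s : S) :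
    ℕ → List S × S
  | 0 => ([], s)
  | n + 1 =>
      let prev := playAux S1 σ π s n
      (prev.1 ++ [prev.2],
        if prev.2 ∈ S1 then σ prev.1 prev.2 else π prev.1 prev.2)

/-- The unique play `ω(s, σ, π)` starting from `s` in which player 1 follows `σ`
and player 2 follows `π`. -/
noncomputable def play {S : Type} (S1 : Set S) (σ π : List S → S → S) (s : S)
    (n : ℕ) : S :=
  (playAux S1 σ π s n).2

/-- The winning set of player 1 for the objective `Φ` in the game with carrier `C`. -/
def W1 {S : Type} (C : Set S) (E : S → S → Prop) (S1 : Set S)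
    (Φ : Set (ℕ → S)) : Set S :=
  {s | s ∈ C ∧ ∃ σ, Strategy1 C E S1 σ ∧
        ∀ π, Strategy2 C E S1 π → play S1 σ π s ∈ Φ}

/-- The winning set of player 2 for the objective `Ψ` in the game with carrier `C`. -/
def W2 {S : Type} (C : Set S) (E : S → S → Prop) (S1 : Set S)
    (Ψ : Set (ℕ → S)) : Set S :=
  {s | s ∈ C ∧ ∃ π, Strategy2 C E S1 π ∧
        ∀ σ, Strategy1 C E S1 σ → play S1 σ π s ∈ Ψ}

/-- The reachability objective: some state of `T` is visited. -/
def Reach {S : Type} (T : Set S) : Set (ℕ → S) := {ω | ∃ k, ω k ∈ T}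

/-- The safety objective: only states of `F` are visited. -/
def Safe {S : Type} (F : Set S) : Set (ℕ → S) := {ω | ∀ k, ω k ∈ F}

/-- The weak-parity objective for player 1: the minimal priority occurring in the
play is even. -/
def WeakParityEven {S : Type} (p : S → ℕ) : Set (ℕ → S) :=
  {ω | Even (sInf (p '' Set.range ω))}

/-- The weak-parity objective for player 2: the minimal priority occurring in the
play is odd. -/
def WeakParityOdd {S : Type} (p : S → ℕ) : Set (ℕ → S) :=
  {ω | Odd (sInf (p '' Set.range ω))}

/-- The player-1 attractor of `U` in the game with carrier `C`. -/
def Attr1 {S : Type} (C : Set S) (E : S → S → Prop) (S1 : Set S) (U : Set S) :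
    Set S :=
  W1 C E S1 (Reach U)

/-- The player-2 attractor of `U` in the game with carrier `C`. -/
def Attr2 {S : Type} (C : Set S) (E : S → S → Prop) (S1 : Set S) (U : Set S) :
    Set S :=
  W2 C E S1 (Reach U)

/-- The inductive attractor computation for player 1:
`R₀ = U` and `R_{i+1} = R_i ∪ {s ∈ S₁ ∣ E(s) ∩ R_i ≠ ∅} ∪ {s ∈ S₂ ∣ E(s) ⊆ R_i}`. -/
def Rseq {S : Type} (E : S → S → Prop) (S1 : Set S) (U : Set S) : ℕ → Set S
  | 0 => U
  | i + 1 =>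
      Rseq E S1 U i ∪ {s | s ∈ S1 ∧ ∃ t ∈ Rseq E S1 U i, E s t} ∪
        {s | s ∉ S1 ∧ ∀ t, E s t → t ∈ Rseq E S1 U i}

/-- One step of the classical algorithm: the attractor, inside the sub-game with
carrier `C`, for player `(i mod 2) + 1` to the set of states of priority `i` in `C`. -/
noncomputable def attrStep {S : Type} (E : S → S → Prop) (S1 : Set S) (p : S → ℕ)
    (C : Set S) (i : ℕ) : Set S :=
  if Even i then Attr1 C E S1 ((p ⁻¹' {i}) ∩ C)
  else Attr2 C E S1 ((p ⁻¹' {i}) ∩ C)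

/-- The state space `Sⁱ` of the sub-game `Gⁱ` in the classical algorithm:
`S⁰ = S` and `S^{i+1} = Sⁱ \ Aᵢ`. -/
noncomputable def algoS {S : Type} (E : S → S → Prop) (S1 : Set S) (p : S → ℕ) :
    ℕ → Set S
  | 0 => Set.univ
  | i + 1 => algoS E S1 p i \ attrStep E S1 p (algoS E S1 p i) i

/-- The attractor set `Aᵢ = Attr_{(i mod 2)+1}(p⁻¹(i) ∩ Sⁱ, Gⁱ)` of the classical
algorithm. -/
noncomputable def algoA {S : Type} (E : S → S → Prop) (S1 : Set S) (p : S → ℕ)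
    (i : ℕ) : Set S :=
  attrStep E S1 p (algoS E S1 p i) i

theorem play_zero {S : Type} (S1 : Set S) (σ π : List S → S → S) (s : S) :
    play S1 σ π s 0 = s := rfl

theorem play_succ {S : Type} (S1 : Set S) (σ π : List S → S → S) (s : S) (n : ℕ) :
    (play S1 σ π s n ∈ S1 ∧
      play S1 σ π s (n+1) = σ (playAux S1 σ π s n).1 (play S1 σ π s n)) ∨
    (play S1 σ π s n ∉ S1 ∧
      play S1 σ π s (n+1) = π (playAux S1 σ π s n).1 (play S1 σ π s n)) := by
  unfold play
  by_cases h : (playAux S1 σ π s n).2 ∈ S1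
  · left
    refine ⟨h, ?_⟩
    simp [playAux, h]
  · right
    refine ⟨h, ?_⟩
    simp [playAux, h]

theorem playAux_compl {S : Type} (S1 : Set S) (σ π : List S → S → S) (s : S) (n : ℕ) :
    playAux S1ᶜ π σ s n = playAux S1 σ π s n := by
  induction n with
  | zero => rfl
  | succ n ih =>
    by_cases h : (playAux S1 σ π s n).2 ∈ S1 <;> simp [playAux, ih, h]

theorem play_compl {S : Type} (S1 : Set S) (σ π : List S → S → S) (s : S) :
    play S1ᶜ π σ s = play S1 σ π s := by
  funext n
  unfold play
  rw [playAux_compl]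

theorem W2_eq {S : Type} (C : Set S) (E : S → S → Prop) (S1 : Set S) (Φ : Set (ℕ → S)) :
    W2 C E S1 Φ = W1 C E S1ᶜ Φ := by
  ext s
  simp only [W1, W2, Strategy1, Strategy2, Set.mem_ofPred_eq, play_compl, Set.mem_compl_iff,
    not_not]

/-- Winning lemma. -/
theorem win_aux {S : Type} (E : S → S → Prop) (Q : Set S) (p l r : S → ℕ) (good : ℕ → Prop)
    (h1 : ∀ s ∈ Q, ∃ t, E s t ∧ l s ≤ l t ∧
      (good (l s) → p s ≠ l s → l t = l s ∧ r t < r s))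
    (h2 : ∀ s, s ∉ Q → ∀ t, E s t → (l t < l s → good (l t)) ∧
      (good (l s) → p s ≠ l s → l s ≤ l t → l t = l s ∧ r t < r s))
    (h3 : ∀ s, l s ≤ p s) (s : S) (hs : good (l s)) :
    s ∈ W1 Set.univ E Q {ω | good (sInf (p '' Set.range ω))} := by
  choose! f hf using h1
  refine ⟨trivial, fun _ s => f s, fun w s _ hs => ⟨(hf s hs).1, trivial⟩, ?_⟩
  intro π hπ
  show good _
  set ω := play Q (fun _ s => f s) π s with hω
  have step : ∀ n, (l (ω (n+1)) < l (ω n) → good (l (ω (n+1)))) ∧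
      (good (l (ω n)) → p (ω n) ≠ l (ω n) → l (ω n) ≤ l (ω (n+1)) →
        l (ω (n+1)) = l (ω n) ∧ r (ω (n+1)) < r (ω n)) := by
    intro n
    rcases play_succ Q (fun _ s => f s) π s n with ⟨hq, he⟩ | ⟨hq, he⟩
    · rw [← hω] at hq he
      rw [he]
      have := hf _ hq
      exact ⟨fun h => absurd this.2.1 (by simpa using h), fun a b _ => this.2.2 a b⟩
    · rw [← hω] at hq he
      have := h2 _ hq _ (hπ (playAux Q (fun _ s => f s) π s n).1 _ trivial hq).1
      rw [he]
      exact this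
  -- minimal level, first occurrence
  obtain ⟨n0, hn0⟩ : ∃ n0, ∀ k, l (ω n0) ≤ l (ω k) := by
    obtain ⟨_, ⟨n0, rfl⟩, h⟩ := WellFounded.has_min (measure l).wf (Set.range ω) ⟨_, 0, rfl⟩
    exact ⟨n0, fun k => not_lt.1 (h _ ⟨k, rfl⟩)⟩
  have hgood : ∀ n, ∃ k ≤ n, good (l (ω k)) ∧ ∀ j ≤ n, l (ω k) ≤ l (ω j) := by
    intro n
    induction n with
    | zero => exact ⟨0, le_rfl, hs, fun j hj => by simp [Nat.le_zero.1 hj]⟩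
    | succ n ih =>
      obtain ⟨k, hk, hg, hm⟩ := ih
      by_cases hlt : l (ω (n+1)) < l (ω k)
      · refine ⟨n+1, le_rfl, (step n).1 (hlt.trans_le (hm n le_rfl)), fun j hj => ?_⟩
        rcases Nat.le_succ_iff.1 hj with h | h
        · exact hlt.le.trans (hm j h)
        · rw [h]
      · refine ⟨k, hk.trans (Nat.le_succ _), hg, fun j hj => ?_⟩
        rcases Nat.le_succ_iff.1 hj with h | h
        · exact hm j h
        · rw [h]; exact not_lt.1 hlt
  have hg0 : good (l (ω n0)) := by
    obtain ⟨k, _, hg, hm⟩ := hgood n0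
    rwa [le_antisymm (hn0 k) (hm n0 le_rfl)]
  have hreach : ∀ m n, r (ω n) ≤ m → l (ω n) = l (ω n0) → ∃ k, p (ω k) = l (ω n0) := by
    intro m
    induction m with
    | zero =>
      intro n hr hl
      by_contra hcon
      push Not at hcon
      have := (step n).2 (hl ▸ hg0) (hl ▸ hcon n) (hl ▸ hn0 _)
      omega
    | succ m ih =>
      intro n hr hl
      by_cases hpn : p (ω n) = l (ω n)
      · exact ⟨n, hpn.trans hl⟩
      · have := (step n).2 (hl ▸ hg0) hpn (hl ▸ hn0 _)
        exact ih (n+1) (by omega) (this.1.trans hl)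
  obtain ⟨k, hk⟩ := hreach _ n0 le_rfl rfl
  have : sInf (p '' Set.range ω) = l (ω n0) := by
    apply le_antisymm
    · rw [← hk]
      exact Nat.sInf_le ⟨_, ⟨k, rfl⟩, rfl⟩
    · apply le_csInf ((Set.range_nonempty ω).image p)
      rintro _ ⟨_, ⟨j, rfl⟩, rfl⟩
      exact (hn0 j).trans (h3 _)
  rwa [this]

/-- Ranked attractor relative to the carrier `C`. -/
def RC {S : Type} (C : Set S) (E : S → S → Prop) (Q U : Set S) : ℕ → Set S
  | 0 => U
  | i + 1 => RC C E Q U i ∪ {s | s ∈ C ∧ s ∈ Q ∧ ∃ t ∈ RC C E Q U i, E s t} ∪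
        {s | s ∈ C ∧ s ∉ Q ∧ ∀ t ∈ C, E s t → t ∈ RC C E Q U i}

theorem RC_mono {S : Type} (C : Set S) (E : S → S → Prop) (Q U : Set S) :
    Monotone (RC C E Q U) :=
  monotone_nat_of_le_succ fun _ _ h => Or.inl (Or.inl h)

theorem RC_sub {S : Type} (C : Set S) (E : S → S → Prop) (Q U : Set S) (hU : U ⊆ C) (n : ℕ) :
    RC C E Q U n ⊆ C := by
  induction n with
  | zero => exact hU
  | succ n ih =>
    rintro s ((h | h) | h)
    · exact ih h
    · exact h.1
    · exact h.1

theorem attr_facts {S : Type} [Finite S] (C : Set S) (E : S → S → Prop) (Q U : Set S)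
    (hU : U ⊆ C) (hC : ∀ s ∈ C, ∃ t ∈ C, E s t) :
    ∃ r : S → ℕ,
      (∀ s ∈ W1 C E Q (Reach U), s ∉ U → s ∈ Q →
        ∃ t ∈ W1 C E Q (Reach U), E s t ∧ r t < r s) ∧
      (∀ s ∈ W1 C E Q (Reach U), s ∉ U → s ∉ Q → ∀ t ∈ C, E s t →
        t ∈ W1 C E Q (Reach U) ∧ r t < r s) ∧
      (∀ s ∈ C, s ∉ W1 C E Q (Reach U) → s ∈ Q → ∀ t ∈ C, E s t →
        t ∉ W1 C E Q (Reach U)) ∧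
      (∀ s ∈ C, s ∉ W1 C E Q (Reach U) → s ∉ Q → ∃ t ∈ C, E s t ∧
        t ∉ W1 C E Q (Reach U)) ∧
      U ⊆ W1 C E Q (Reach U) := by
  set B : Set S := {s | ∃ n, s ∈ RC C E Q U n} with hB
  have hBC : B ⊆ C := fun s ⟨n, h⟩ => RC_sub C E Q U hU n h
  have hUB : U ⊆ B := fun s h => ⟨0, h⟩
  let r : S → ℕ := fun s => sInf {n | s ∈ RC C E Q U n}
  have hr : ∀ s ∈ B, s ∈ RC C E Q U (r s) := fun s h => Nat.sInf_mem h
  have hr' : ∀ s n, s ∈ RC C E Q U n → r s ≤ n := fun s n h => Nat.sInf_le h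
  have ha : ∀ s ∈ B, s ∉ U → (s ∈ Q → ∃ t ∈ B, E s t ∧ r t < r s) ∧
      (s ∉ Q → ∀ t ∈ C, E s t → t ∈ B ∧ r t < r s) := by
    intro s hs hsU
    have h := hr s hs
    rcases hn : r s with _ | n
    · rw [hn] at h; exact absurd h hsU
    · rw [hn] at h
      rcases h with (h | h) | h
      · have := hr' s n h
        omega
      · refine ⟨fun _ => ?_, fun hq => absurd h.2.1 hq⟩
        obtain ⟨t, ht, he⟩ := h.2.2
        exact ⟨t, ⟨n, ht⟩, he, Nat.lt_succ_of_le (hr' t n ht)⟩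
      · refine ⟨fun hq => absurd hq h.2.1, fun _ t ht he => ?_⟩
        have := h.2.2 t ht he
        exact ⟨⟨n, this⟩, Nat.lt_succ_of_le (hr' t n this)⟩
  have hc : ∀ s ∈ C, s ∉ B → s ∈ Q → ∀ t ∈ C, E s t → t ∉ B := by
    rintro s hs hsB hq t ht he ⟨n, hn⟩
    exact hsB ⟨n+1, Or.inl (Or.inr ⟨hs, hq, t, hn, he⟩)⟩
  have hd : ∀ s ∈ C, s ∉ B → s ∉ Q → ∃ t ∈ C, E s t ∧ t ∉ B := by
    intro s hs hsB hq
    by_contra hcon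
    push Not at hcon
    obtain ⟨N, hN⟩ := (Set.finite_range r).bddAbove
    exact hsB ⟨N+1, Or.inr ⟨hs, hq, fun t ht he =>
      RC_mono C E Q U (hN ⟨t, rfl⟩) (hr t (hcon t ht he))⟩⟩
  have key : W1 C E Q (Reach U) = B := by
    apply Set.Subset.antisymm
    · rintro s ⟨hsC, σ, hσ, hwin⟩
      by_contra hsB
      have : ∀ s, ∃ t, s ∈ C → (E s t ∧ t ∈ C ∧ (s ∉ B → s ∉ Q → t ∉ B)) := by
        intro s
        by_cases hs : s ∈ C
        · by_cases hh : s ∉ B ∧ s ∉ Q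
          · obtain ⟨t, h1, h2, h3⟩ := hd s hs hh.1 hh.2
            exact ⟨t, fun _ => ⟨h2, h1, fun _ _ => h3⟩⟩
          · obtain ⟨t, h1, h2⟩ := hC s hs
            exact ⟨t, fun _ => ⟨h2, h1, fun a b => absurd ⟨a, b⟩ hh⟩⟩
        · exact ⟨s, fun h => absurd h hs⟩
      choose g hg using this
      obtain ⟨k, hk⟩ := hwin (fun _ s => g s) (fun w s hs _ => ⟨(hg s hs).1, (hg s hs).2.1⟩)
      have inv : ∀ n, play Q σ (fun _ s => g s) s n ∈ C ∧
          play Q σ (fun _ s => g s) s n ∉ B := by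
        intro n
        induction n with
        | zero => exact ⟨hsC, hsB⟩
        | succ n ih =>
          rcases play_succ Q σ (fun _ s => g s) s n with ⟨hq, he⟩ | ⟨hq, he⟩
          · rw [he]
            have := hσ (playAux Q σ (fun _ s => g s) s n).1 _ ih.1 hq
            exact ⟨this.2, hc _ ih.1 ih.2 hq _ this.2 this.1⟩
          · rw [he]
            have := hg _ ih.1
            exact ⟨this.2.1, this.2.2 ih.2 hq⟩
      exact (inv k).2 (hUB hk)
    · intro s hs
      have : ∀ s, ∃ t, s ∈ C → (E s t ∧ t ∈ C ∧ (s ∈ B → s ∉ U → s ∈ Q → t ∈ B ∧ r t < r s)) := by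
        intro s
        by_cases hs : s ∈ C
        · by_cases hh : s ∈ B ∧ s ∉ U ∧ s ∈ Q
          · obtain ⟨t, h1, h2, h3⟩ := (ha s hh.1 hh.2.1).1 hh.2.2
            exact ⟨t, fun _ => ⟨h2, hBC h1, fun _ _ _ => ⟨h1, h3⟩⟩⟩
          · obtain ⟨t, h1, h2⟩ := hC s hs
            exact ⟨t, fun _ => ⟨h2, h1, fun a b c => absurd ⟨a, b, c⟩ hh⟩⟩
        · exact ⟨s, fun h => absurd h hs⟩
      choose f hf using this
      refine ⟨hBC hs, fun _ s => f s, fun w s hs _ => ⟨(hf s hs).1, (hf s hs).2.1⟩, ?_⟩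
      intro π hπ
      by_contra hcon
      have hcon' : ∀ k, play Q (fun _ s => f s) π s k ∉ U := fun k hk => hcon ⟨k, hk⟩
      have inv : ∀ n, play Q (fun _ s => f s) π s n ∈ B ∧
          r (play Q (fun _ s => f s) π s n) + n ≤ r s := by
        intro n
        induction n with
        | zero => exact ⟨hs, le_rfl⟩
        | succ n ih =>
          rcases play_succ Q (fun _ s => f s) π s n with ⟨hq, he⟩ | ⟨hq, he⟩
          · rw [he]
            have := (hf _ (hBC ih.1)).2.2 ih.1 (hcon' n) hq
            exact ⟨this.1, by have := this.2; have := ih.2; omega⟩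
          · rw [he]
            have h1 := hπ (playAux Q (fun _ s => f s) π s n).1 _ (hBC ih.1) hq
            have := (ha _ ih.1 (hcon' n)).2 hq _ h1.2 h1.1
            exact ⟨this.1, by have := this.2; have := ih.2; omega⟩
      have := (inv (r s + 1)).2
      omega
  rw [key]
  exact ⟨r, fun s h1 h2 => (ha s h1 h2).1, fun s h1 h2 => (ha s h1 h2).2, hc, hd, hUB⟩

theorem attrStep_eq {S : Type} (E : S → S → Prop) (S1 : Set S) (p : S → ℕ)
    (C : Set S) (i : ℕ) :
    attrStep E S1 p C i =
      W1 C E (if Even i then S1 else S1ᶜ) (Reach ((p ⁻¹' {i}) ∩ C)) := by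
  unfold attrStep Attr1 Attr2
  split_ifs
  · rfl
  · rw [W2_eq]

theorem algoS_total {S : Type} [Finite S] (E : S → S → Prop) (S1 : Set S)
    (hE : ∀ s, ∃ t, E s t) (p : S → ℕ) (i : ℕ) :
    ∀ s ∈ algoS E S1 p i, ∃ t ∈ algoS E S1 p i, E s t := by
  induction i with
  | zero =>
    intro s _
    obtain ⟨t, h⟩ := hE s
    exact ⟨t, trivial, h⟩
  | succ i ih =>
    obtain ⟨r, -, -, hc, hd, -⟩ := attr_facts (algoS E S1 p i) E
      (if Even i then S1 else S1ᶜ) ((p ⁻¹' {i}) ∩ algoS E S1 p i) Set.inter_subset_right ih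
    rintro s ⟨hs, hsA⟩
    rw [attrStep_eq] at hsA
    simp only [algoS, attrStep_eq]
    by_cases hq : s ∈ (if Even i then S1 else S1ᶜ)
    · obtain ⟨t, ht, he⟩ := ih s hs
      exact ⟨t, ⟨ht, hc s hs hsA hq t ht he⟩, he⟩
    · obtain ⟨t, ht, he, hn⟩ := hd s hs hsA hq
      exact ⟨t, ⟨ht, hn⟩, he⟩

theorem mem_algoS {S : Type} (E : S → S → Prop) (S1 : Set S) (p : S → ℕ) (i : ℕ) (s : S) :
    s ∈ algoS E S1 p i ↔ ∀ j < i, s ∉ algoA E S1 p j := by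
  induction i with
  | zero => simp [algoS]
  | succ i ih =>
    rw [algoS, Set.mem_sdiff, ih]
    constructor
    · rintro ⟨h1, h2⟩ j hj
      rcases Nat.lt_succ_iff_lt_or_eq.1 hj with h | rfl
      · exact h1 j h
      · exact h2
    · exact fun h => ⟨fun j hj => h j (by omega), h i (by omega)⟩

/-- **Correctness of the classical algorithm.** The union of the
even-indexed attractor sets `Aᵢ` is exactly the winning set of player 1 for the
weak-parity objective, and the union of the odd-indexed attractor sets is its
complement and exactly the winning set of player 2 for the complementary
objective. -/
theorem classical_algorithm_correct {S : Type} [Fintype S]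
    (E : S → S → Prop) (S1 : Set S) (hE : ∀ s, ∃ t, E s t)
    (d : ℕ) (p : S → ℕ) (hp : ∀ s, p s < d) :
    ((⋃ i ∈ {i : ℕ | i < d ∧ Even i}, algoA E S1 p i) =
        W1 Set.univ E S1 (WeakParityEven p)) ∧
      ((⋃ i ∈ {i : ℕ | i < d ∧ Odd i}, algoA E S1 p i) =
        Set.univ \ (⋃ i ∈ {i : ℕ | i < d ∧ Even i}, algoA E S1 p i)) ∧
      ((⋃ i ∈ {i : ℕ | i < d ∧ Odd i}, algoA E S1 p i) =
        W2 Set.univ E S1 (WeakParityOdd p)) := by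
  have facts := fun i => attr_facts (algoS E S1 p i) E
      (if Even i then S1 else S1ᶜ) ((p ⁻¹' {i}) ∩ algoS E S1 p i) Set.inter_subset_right
      (algoS_total E S1 hE p i)
  simp only [← attrStep_eq] at facts
  change ∀ i, ∃ r : S → ℕ,
      (∀ s ∈ algoA E S1 p i, s ∉ _ → s ∈ _ →
        ∃ t ∈ algoA E S1 p i, E s t ∧ r t < r s) ∧
      (∀ s ∈ algoA E S1 p i, s ∉ _ → s ∉ _ → ∀ t ∈ _, E s t →
        t ∈ algoA E S1 p i ∧ r t < r s) ∧
      (∀ s ∈ _, s ∉ algoA E S1 p i → s ∈ _ → ∀ t ∈ _, E s t →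
        t ∉ algoA E S1 p i) ∧
      (∀ s ∈ _, s ∉ algoA E S1 p i → s ∉ _ → ∃ t ∈ _, E s t ∧
        t ∉ algoA E S1 p i) ∧
      _ ⊆ algoA E S1 p i at facts
  choose rk ha hb hc hd hU using facts
  have hAS : ∀ i, algoA E S1 p i ⊆ algoS E S1 p i := by
    intro i s hs
    unfold algoA at hs
    rw [attrStep_eq] at hs
    exact hs.1
  have hex : ∀ s, ∃ i, i ≤ p s ∧ s ∈ algoA E S1 p i := by
    intro s
    by_contra hcon
    push Not at hcon
    have : s ∈ algoS E S1 p (p s) :=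
      (mem_algoS E S1 p _ s).2 fun j hj => hcon j hj.le
    exact hcon (p s) le_rfl (hU _ ⟨rfl, this⟩)
  choose l hlp hlA using hex
  have huniq : ∀ i s, s ∈ algoA E S1 p i → l s = i := by
    intro i s hs
    rcases lt_trichotomy (l s) i with h | h | h
    · exact absurd (hlA s) ((mem_algoS E S1 p i s).1 (hAS _ hs) _ h)
    · exact h
    · exact absurd hs ((mem_algoS E S1 p _ s).1 (hAS _ (hlA s)) _ h)
  have hSl : ∀ i s, s ∈ algoS E S1 p i ↔ i ≤ l s := by
    intro i s
    rw [mem_algoS]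
    constructor
    · intro h
      by_contra hlt
      exact h _ (not_le.1 hlt) (hlA s)
    · intro h j hj hjA
      have := huniq j s hjA
      omega
  have win : ∀ (Q : Set S) (good : ℕ → Prop),
      (∀ i, good i → (if Even i then S1 else S1ᶜ) = Q) →
      (∀ i, ¬ good i → (if Even i then S1 else S1ᶜ) = Qᶜ) →
      ∀ s, good (l s) → s ∈ W1 Set.univ E Q {ω | good (sInf (p '' Set.range ω))} := by
    intro Q good hg hng
    apply win_aux E Q p l (fun s => rk (l s) s) good _ _ hlp
    · intro s hq
      by_cases hh : good (l s) ∧ p s ≠ l s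
      · obtain ⟨t, ht, he, hlt⟩ := ha (l s) s (hlA s) (fun h => hh.2 h.1)
          (by rw [hg _ hh.1]; exact hq)
        have := huniq _ _ ht
        exact ⟨t, he, this.ge, fun _ _ => ⟨this, by simpa only [this] using hlt⟩⟩
      · obtain ⟨t, ht, he⟩ := algoS_total E S1 hE p (l s) s (hAS _ (hlA s))
        exact ⟨t, he, (hSl _ _).1 ht, fun a b => absurd ⟨a, b⟩ hh⟩
    · intro s hq t he
      constructor
      · intro hlt
        by_contra hn
        refine hc (l t) s ((hSl _ _).2 hlt.le) (fun h => ?_) (by rw [hng _ hn]; exact hq) t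
          ((hSl _ _).2 le_rfl) he (hlA t)
        have := huniq _ _ h
        omega
      · intro hgood hps hle
        have := hb (l s) s (hlA s) (fun h => hps h.1) (by rw [hg _ hgood]; exact hq) t
          ((hSl _ _).2 hle) he
        have h' := huniq _ _ this.1
        exact ⟨h', by simpa only [h'] using this.2⟩
  have win1 : ∀ s, Even (l s) → s ∈ W1 Set.univ E S1 (WeakParityEven p) :=
    win S1 Even (fun i h => if_pos h) (fun i h => if_neg h)
  have win2 : ∀ s, Odd (l s) → s ∈ W2 Set.univ E S1 (WeakParityOdd p) := by
    rw [W2_eq]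
    refine win S1ᶜ Odd (fun i h => if_neg (Nat.not_even_iff_odd.2 h)) (fun i h => ?_)
    rw [if_pos (Nat.not_odd_iff_even.1 h), compl_compl]
  have disj : ∀ s, s ∈ W1 Set.univ E S1 (WeakParityEven p) →
      s ∈ W2 Set.univ E S1 (WeakParityOdd p) → False := by
    rintro s ⟨-, σ, hσ, h1⟩ ⟨-, π, hπ, h2⟩
    exact Nat.not_even_iff_odd.2 (h2 σ hσ) (h1 π hπ)
  have hmem : ∀ (P : ℕ → Prop) s,
      s ∈ (⋃ i ∈ {i : ℕ | i < d ∧ P i}, algoA E S1 p i) ↔ P (l s) := by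
    intro P s
    simp only [Set.mem_iUnion, Set.mem_ofPred_eq, exists_prop]
    constructor
    · rintro ⟨i, ⟨_, hP⟩, hi⟩
      rwa [huniq _ _ hi]
    · exact fun h => ⟨l s, ⟨(hlp s).trans_lt (hp s), h⟩, hlA s⟩
  refine ⟨?_, ?_, ?_⟩
  · ext s
    rw [hmem]
    refine ⟨win1 s, fun h => ?_⟩
    by_contra hn
    exact disj s h (win2 s (Nat.not_even_iff_odd.1 hn))
  · ext s
    rw [Set.mem_sdiff, hmem, hmem]
    simp
  · ext s
    rw [hmem]
    refine ⟨win2 s, fun h => ?_⟩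
    by_contra hn
    exact disj s (win1 s (Nat.not_odd_iff_even.1 hn)) h
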